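/- arXiv:2402.07604 — 2 statements merged into one kernel-verified Lean document; each statement's English description precedes it below -/
import Mathlib

section
/- For every integer n ≥ 1, one has √(2πn)·(n/e)^n·e^{1/(12n+1)} < n! < √(2πn)·(n/e)^n·e^{1/(12n)}. -/
open Real

lemma step_lower (m : ℕ) :
    1 / (12 * ((m : ℝ) + 1) + 1) - 1 / (12 * ((m : ℝ) + 2) + 1)
      < log (Stirling.stirlingSeq (m + 1)) - log (Stirling.stirlingSeq (m + 2)) := by
  have h := Stirling.log_stirlingSeq_sdiff_hasSum m
  have h1 := h.summable.le_tsum 0 (fun k _ => by positivity)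
  rw [h.tsum_eq] at h1
  refine lt_of_lt_of_le ?_ h1
  have hm : (0 : ℝ) ≤ m := Nat.cast_nonneg m
  push_cast
  rw [div_sub_div _ _ (by positivity) (by positivity)]
  have : (1 : ℝ) / (2 * 1 + 1) * ((1 / (2 * ((m : ℝ) + 1) + 1)) ^ 2) ^ 1
      = 1 / (3 * (2 * ((m : ℝ) + 1) + 1) ^ 2) := by
    rw [pow_one, div_pow, one_pow, div_mul_div_comm]
    norm_num
  rw [this, div_lt_div_iff₀ (by positivity) (by positivity)]
  nlinarith

lemma step_upper (m : ℕ) :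
    log (Stirling.stirlingSeq (m + 1)) - log (Stirling.stirlingSeq (m + 2))
      < 1 / (12 * ((m : ℝ) + 1)) - 1 / (12 * ((m : ℝ) + 2)) := by
  have h := Stirling.log_stirlingSeq_sdiff_hasSum m
  have hm : (0 : ℝ) ≤ m := Nat.cast_nonneg m
  set x : ℝ := (1 / (2 * ((m + 1 : ℕ) : ℝ) + 1)) ^ 2 with hx
  have hx0 : 0 < x := by positivity
  have hx1 : x < 1 := by
    rw [hx, div_pow, div_lt_one (by positivity)]
    push_cast
    nlinarith
  have g := (hasSum_geometric_of_lt_one hx0.le hx1).mul_left (x / 3)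
  have e : x / 3 * (1 - x)⁻¹ = 1 / (12 * ((m : ℝ) + 1)) - 1 / (12 * ((m : ℝ) + 2)) := by
    have h3 : 1 - x ≠ 0 := by linarith
    have h4 : x * (2 * ((m : ℝ) + 1) + 1) ^ 2 = 1 := by
      rw [hx]; push_cast; field_simp
    field_simp
    linear_combination 3 * h4
  rw [← e]
  refine hasSum_lt (i := 1) (fun k => ?_) ?_ h g
  · have : (1 : ℝ) / (2 * ((k + 1 : ℕ) : ℝ) + 1) ≤ 1 / 3 := by
      apply one_div_le_one_div_of_le (by norm_num)
      push_cast
      have : (0 : ℝ) ≤ k := Nat.cast_nonneg k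
      linarith
    calc _ ≤ 1 / 3 * x ^ (k + 1) := by gcongr
      _ = _ := by ring
  · have : 0 < x ^ 2 := by positivity
    norm_num
    nlinarith

lemma log_lim : Filter.Tendsto (fun k : ℕ => log (Stirling.stirlingSeq (k + 1)))
    Filter.atTop (nhds (log (√π))) :=
  ((Real.continuousAt_log (by positivity)).tendsto.comp
    Stirling.tendsto_stirlingSeq_sqrt_pi).comp (Filter.tendsto_add_atTop_nat 1)

lemma lim_aux (c : ℝ) (hc : 0 ≤ c) :
    Filter.Tendsto (fun k : ℕ => 1 / (12 * ((k : ℝ) + 1) + c)) Filter.atTop (nhds 0) := by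
  refine squeeze_zero (fun k => by positivity) (fun k => ?_)
    (tendsto_one_div_add_atTop_nhds_zero_nat (𝕜 := ℝ))
  have : (0 : ℝ) ≤ k := Nat.cast_nonneg k
  apply one_div_le_one_div_of_le (by positivity)
  linarith

lemma log_lower (m : ℕ) :
    log (√π) + 1 / (12 * ((m : ℝ) + 1) + 1) < log (Stirling.stirlingSeq (m + 1)) := by
  have hanti : StrictAnti (fun k : ℕ =>
      log (Stirling.stirlingSeq (k + 1)) - 1 / (12 * ((k : ℝ) + 1) + 1)) := by
    apply strictAnti_nat_of_succ_lt
    intro k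
    have := step_lower k
    push_cast
    rw [show (k : ℝ) + 1 + 1 = k + 2 by ring, show k + 1 + 1 = k + 2 from rfl]
    linarith
  have hl := log_lim.sub (lim_aux 1 (by norm_num))
  have h1 := hanti.antitone.le_of_tendsto hl (m + 1)
  have h2 := hanti (Nat.lt_succ_self m)
  have h3 := lt_of_le_of_lt h1 h2
  simp only at h3
  linarith

lemma log_upper (m : ℕ) :
    log (Stirling.stirlingSeq (m + 1)) < log (√π) + 1 / (12 * ((m : ℝ) + 1)) := by
  have hmono : StrictMono (fun k : ℕ =>
      log (Stirling.stirlingSeq (k + 1)) - 1 / (12 * ((k : ℝ) + 1) + 0)) := by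
    apply strictMono_nat_of_lt_succ
    intro k
    have := step_upper k
    push_cast
    rw [show (k : ℝ) + 1 + 1 = k + 2 by ring, show k + 1 + 1 = k + 2 from rfl, add_zero, add_zero]
    linarith
  have hl := log_lim.sub (lim_aux 0 le_rfl)
  have h1 := hmono.monotone.ge_of_tendsto hl (m + 1)
  have h2 := hmono (Nat.lt_succ_self m)
  have h3 := lt_of_lt_of_le h2 h1
  simp only [add_zero] at h3
  linarith

/-- Robbins' pointwise version of Stirling's formula: for every `n ≥ 1`,
`√(2πn)·(n/e)^n·e^{1/(12n+1)} < n! < √(2πn)·(n/e)^n·e^{1/(12n)}`. -/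
theorem robbins_stirling (n : ℕ) (hn : 1 ≤ n) :
    Real.sqrt (2 * π * n) * ((n : ℝ) / Real.exp 1) ^ n * Real.exp (1 / (12 * n + 1))
        < (n.factorial : ℝ) ∧
      (n.factorial : ℝ)
        < Real.sqrt (2 * π * n) * ((n : ℝ) / Real.exp 1) ^ n * Real.exp (1 / (12 * n)) := by
  obtain ⟨m, rfl⟩ : ∃ m, n = m + 1 := ⟨n - 1, by omega⟩
  have hl := log_lower m
  have hu := log_upper m
  have hs := Stirling.stirlingSeq'_pos m
  rw [Real.lt_log_iff_exp_lt hs, Real.exp_add, Real.exp_log (by positivity)] at hl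
  rw [Real.log_lt_iff_lt_exp hs, Real.exp_add, Real.exp_log (by positivity)] at hu
  have hc : (((m + 1 : ℕ)) : ℝ) = (m : ℝ) + 1 := by push_cast; ring
  rw [← hc] at hl hu
  have hN : (0 : ℝ) < ((m + 1 : ℕ) : ℝ) := by positivity
  unfold Stirling.stirlingSeq at hl hu
  generalize hNN : ((m + 1 : ℕ) : ℝ) = N at *
  have hD : 0 < √(2 * N) * (N / rexp 1) ^ (m + 1) := by positivity
  have hsq : √(2 * π * N) = √π * √(2 * N) := by
    rw [← Real.sqrt_mul pi_pos.le]; ring_nf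
  rw [lt_div_iff₀ hD] at hl
  rw [div_lt_iff₀ hD] at hu
  rw [hsq]
  constructor
  · refine lt_of_eq_of_lt ?_ hl
    ring
  · refine lt_of_lt_of_eq hu ?_
    ring
end

section
/- Let K be a totally real number field of degree d with absolute discriminant D, class number h_K, regulator R_K, and Dedekind zeta function ζ_K. Then for every real t > 0: R_K·h_K ≤ t(t+1)·2^{1−d}·(π^{−d}·D)^{(1+t)/2}·Γ((1+t)/2)^d·ζ_K(1+t). -/
open NumberField Real

/-- The Dedekind zeta function of `K` at a real argument `s`, as a sum of `N(I)^{-s}`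
over the nonzero ideals `I` of the ring of integers of `K`. -/
noncomputable def dedekindZetaReal (K : Type*) [Field K] [NumberField K] (s : ℝ) : ℝ :=
  ∑' I : {I : Ideal (𝓞 K) // I ≠ ⊥}, ((Ideal.absNorm (I : Ideal (𝓞 K)) : ℝ)) ^ (-s)

section Analytic
open MeasureTheory ENNReal

/-- The theta-type inequality: no Poisson summation is needed. -/
theorem bs_theta_generic {E : Type*} [NormedAddCommGroup E] [MeasurableSpace E] [BorelSpace E]
    (μ : Measure E) [μ.IsAddLeftInvariant]
    (L : Submodule ℤ E) [Countable L] (F : Set E) (hF : IsAddFundamentalDomain L F μ)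
    (g : E → ℝ≥0∞) (hg : Measurable g) :
    (∫⁻ v, g v ∂μ) ^ 2 ≤ μ F * ∑' x : L, ∫⁻ v, g v * g (x + v) ∂μ := by
  have : MeasurableVAdd L E := (inferInstance : MeasurableVAdd L.toAddSubgroup E)
  have : VAddInvariantMeasure L E μ := (inferInstance : VAddInvariantMeasure L.toAddSubgroup E μ)
  have hm : ∀ x : L, Measurable fun v => g ((x : E) + v) := fun x =>
    hg.comp (measurable_const_add _)
  have h1 : ∑' x : L, ∫⁻ v, g v * g (x + v) ∂μ
      = ∫⁻ v in F, (∑' x : L, g (x + v)) ^ 2 ∂μ := by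
    rw [← lintegral_tsum (f := fun (x : L) v => g v * g (x + v))
      (fun x => (hg.mul (hm x)).aemeasurable)]
    rw [hF.lintegral_eq_tsum'', ← lintegral_tsum]
    · refine lintegral_congr fun v => ?_
      simp_rw [ENNReal.tsum_mul_left, sq]
      rw [← ENNReal.tsum_mul_right]
      refine tsum_congr fun l => ?_
      congr 1
      rw [← (Equiv.addRight l).tsum_eq (fun x : L => g (x + v))]
      refine tsum_congr fun x => ?_
      simp [Submodule.vadd_def, add_assoc]
    · intro l
      apply Measurable.aemeasurable
      apply Measurable.comp (g := fun v => ∑' x : L, g v * g (x + v))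
      · exact Measurable.tsum fun x => hg.mul (hm x)
      · exact measurable_const_add (l : E)
  have h2 : ∫⁻ v, g v ∂μ = ∫⁻ v in F, (∑' x : L, g (x + v)) ∂μ := by
    rw [hF.lintegral_eq_tsum'', ← lintegral_tsum]
    · rfl
    · intro l; exact (hm l).aemeasurable
  rw [h1, h2]
  set G : E → ℝ≥0∞ := fun v => ∑' x : L, g (x + v)
  have hG : Measurable G := Measurable.tsum hm
  have := ENNReal.lintegral_mul_le_Lp_mul_Lq (μ.restrict F) (p := 2) (q := 2)
    (by constructor <;> norm_num) (f := fun _ => 1) (g := G) aemeasurable_const hG.aemeasurable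
  simp only [Pi.mul_apply, one_mul, ENNReal.one_rpow, lintegral_const, MeasurableSet.univ, Measure.restrict_apply, Set.univ_inter] at this
  calc _ ≤ _ := pow_le_pow_left₀ (by simp) this 2
    _ = _ := by
      rw [mul_pow, ← ENNReal.rpow_natCast, ← ENNReal.rpow_natCast, ← ENNReal.rpow_mul, ← ENNReal.rpow_mul]
      norm_num
      rfl

theorem bs_lintegral_prod {ι : Type*} [Fintype ι] (f : ι → ℝ → ℝ) (hf : ∀ i, Integrable (f i))
    (h0 : ∀ i x, 0 ≤ f i x) :
    ∫⁻ x : ι → ℝ, ENNReal.ofReal (∏ i, f i (x i)) = ENNReal.ofReal (∏ i, ∫ x, f i x) := by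
  rw [← integral_fintype_prod_volume_eq_prod, ofReal_integral_eq_lintegral_ofReal]
  · exact Integrable.fintype_prod hf
  · exact Filter.Eventually.of_forall fun x => Finset.prod_nonneg fun i _ => h0 i _

/-- Gaussian in several variables. -/
noncomputable def bsGauss {ι : Type*} [Fintype ι] (x : ι → ℝ) : ℝ := ∏ i, rexp (-(π * x i ^ 2))

theorem bs_gauss_corr (a x : ℝ) (ha : 0 < a) :
    ∫ v : ℝ, rexp (-(2 * π * a ^ 2) * v ^ 2) * rexp (-(2 * π * a ^ 2) * (x + v) ^ 2)
      = rexp (-(π * (a * x) ^ 2)) * (2 * a)⁻¹ := by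
  have : ∀ v : ℝ, rexp (-(2 * π * a ^ 2) * v ^ 2) * rexp (-(2 * π * a ^ 2) * (x + v) ^ 2)
      = rexp (-(π * (a * x) ^ 2)) * (fun v => rexp (-(4 * π * a ^ 2) * v ^ 2)) (v + x / 2) := by
    intro v
    simp only
    rw [← Real.exp_add, ← Real.exp_add]; congr 1; ring
  simp_rw [this]
  rw [integral_const_mul, integral_add_right_eq_self (fun v => rexp (-(4 * π * a ^ 2) * v ^ 2)), integral_gaussian]
  congr 1
  rw [show π / (4 * π * a ^ 2) = ((2 * a)⁻¹) ^ 2 by field_simp; ring, Real.sqrt_sq (by positivity)]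

theorem bs_gauss_corr_int (a x : ℝ) (ha : 0 < a) :
    Integrable fun v : ℝ => rexp (-(2 * π * a ^ 2) * v ^ 2) * rexp (-(2 * π * a ^ 2) * (x + v) ^ 2) := by
  by_contra h
  have := bs_gauss_corr a x ha
  rw [integral_undef h] at this
  have : 0 < rexp (-(π * (a * x) ^ 2)) * (2 * a)⁻¹ := by positivity
  linarith

theorem bs_gauss_sq (a : ℝ) (ha : 0 < a) :
    (∫ v : ℝ, rexp (-(2 * π * a ^ 2) * v ^ 2)) ^ 2 = (2 * a)⁻¹ * a⁻¹ := by
  rw [integral_gaussian, Real.sq_sqrt (by positivity)]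
  field_simp

theorem bs_gamma_int (a s : ℝ) (ha : a ≠ 0) (hs : 0 < s) :
    Integrable (fun u : ℝ => rexp (-(π * (u * a) ^ 2)) * |u| ^ (s - 1)) ∧
    ∫ u : ℝ, rexp (-(π * (u * a) ^ 2)) * |u| ^ (s - 1)
      = π ^ (-s / 2) * Gamma (s / 2) * |a| ^ (-s) := by
  have hb : 0 < π * a ^ 2 := by positivity
  have h1 := integral_rpow_mul_exp_neg_mul_rpow (p := 2) (q := s - 1) (b := π * a ^ 2)
    (by norm_num) (by linarith) hb
  have e : (fun u : ℝ => rexp (-(π * (u * a) ^ 2)) * |u| ^ (s - 1))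
      = fun u : ℝ => (fun u : ℝ => u ^ (s - 1) * rexp (-(π * a ^ 2) * u ^ (2 : ℝ))) |u| := by
    ext u
    simp only [Real.rpow_two, sq_abs]
    rw [mul_comm]; congr 2; ring
  have h2 : ∫ u : ℝ, rexp (-(π * (u * a) ^ 2)) * |u| ^ (s - 1)
      = π ^ (-s / 2) * Gamma (s / 2) * |a| ^ (-s) := by
    rw [e, integral_comp_abs (f := fun u : ℝ => u ^ (s - 1) * rexp (-(π * a ^ 2) * u ^ (2 : ℝ))), h1]
    rw [Real.mul_rpow pi_pos.le (sq_nonneg a), ← sq_abs a, ← Real.rpow_natCast |a| 2, ← Real.rpow_mul (abs_nonneg a)]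
    rw [sub_add_cancel, show ((2 : ℕ) : ℝ) * (-s / 2) = -s by push_cast; ring]
    ring
  refine ⟨?_, h2⟩
  by_contra h
  rw [integral_undef h] at h2
  have : 0 < π ^ (-s / 2) * Gamma (s / 2) * |a| ^ (-s) := by
    have := Real.Gamma_pos_of_pos (half_pos hs)
    have := abs_pos.2 ha
    positivity
  linarith

theorem bs_theta_pi {ι : Type*} [Fintype ι] {E : Type*} [NormedAddCommGroup E]
    [MeasurableSpace E] [BorelSpace E]
    (μ : Measure E) [μ.IsAddLeftInvariant] (p : E →+ (ι → ℝ)) (hp : MeasurePreserving p μ volume)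
    (L : Submodule ℤ E) [Countable L]
    (F : Set E) (hF : IsAddFundamentalDomain L F μ) (u : ι → ℝ) (hu : ∀ i, u i ≠ 0) :
    ENNReal.ofReal (∏ i, |u i|)⁻¹ ≤ μ F * ∑' x : L, ENNReal.ofReal (bsGauss (u * p x)) := by
  have hu' : ∀ i, 0 < |u i| := fun i => abs_pos.2 (hu i)
  have h := bs_theta_generic μ L F hF
    (fun v => ENNReal.ofReal (∏ i, rexp (-(2 * π * |u i| ^ 2) * p v i ^ 2)))
    (Measurable.comp (g := fun v : ι → ℝ => ENNReal.ofReal (∏ i, rexp (-(2 * π * |u i| ^ 2) * v i ^ 2)))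
      (by fun_prop) hp.measurable)
  rw [hp.lintegral_comp (f := fun v : ι → ℝ => ENNReal.ofReal (∏ i, rexp (-(2 * π * |u i| ^ 2) * v i ^ 2)))
    (by fun_prop), bs_lintegral_prod (fun i v => rexp (-(2 * π * |u i| ^ 2) * v ^ 2))
    (fun i => integrable_exp_neg_mul_sq (by have := hu' i; positivity))
    (fun i x => (Real.exp_pos _).le)] at h
  have h3 : ∀ x : L, ∫⁻ v, ENNReal.ofReal (∏ i, rexp (-(2 * π * |u i| ^ 2) * p v i ^ 2)) *
      ENNReal.ofReal (∏ i, rexp (-(2 * π * |u i| ^ 2) * p (x + v) i ^ 2)) ∂μ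
      = ENNReal.ofReal (∏ i, (2 * |u i|)⁻¹) * ENNReal.ofReal (bsGauss (u * p x)) := by
    intro x
    simp_rw [← ENNReal.ofReal_mul (Finset.prod_nonneg fun i _ => (Real.exp_pos _).le),
      ← Finset.prod_mul_distrib, map_add, Pi.add_apply]
    rw [hp.lintegral_comp (f := fun v : ι → ℝ => ENNReal.ofReal (∏ i, rexp (-(2 * π * |u i| ^ 2) * v i ^ 2) *
      rexp (-(2 * π * |u i| ^ 2) * (p x i + v i) ^ 2))) (by fun_prop)]
    rw [bs_lintegral_prod (fun i v => rexp (-(2 * π * |u i| ^ 2) * v ^ 2) *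
      rexp (-(2 * π * |u i| ^ 2) * (p x i + v) ^ 2))
      (fun i => bs_gauss_corr_int _ _ (hu' i)) (fun i x => by positivity),
      ← ENNReal.ofReal_mul (Finset.prod_nonneg fun i _ => by positivity)]
    simp_rw [bs_gauss_corr _ _ (hu' _), bsGauss, Finset.prod_mul_distrib, mul_pow, sq_abs]
    congr 1
    simp only [Pi.mul_apply, mul_pow]
    ring
  simp_rw [h3, ENNReal.tsum_mul_left] at h
  rw [← ENNReal.ofReal_pow (Finset.prod_nonneg fun i _ => integral_nonneg fun x => (Real.exp_pos _).le),
    ← Finset.prod_pow] at h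
  simp_rw [bs_gauss_sq _ (hu' _)] at h
  rw [Finset.prod_mul_distrib, ENNReal.ofReal_mul (Finset.prod_nonneg fun i _ => by positivity),
    mul_left_comm] at h
  rw [← Finset.prod_inv_distrib]
  refine (ENNReal.mul_le_mul_iff_right ?_ ENNReal.ofReal_ne_top).1 h
  simp only [ne_eq, ENNReal.ofReal_eq_zero, not_le]
  exact Finset.prod_pos fun i _ => by have := hu' i; positivity

theorem bs_gamma_pi {ι : Type*} [Fintype ι] (x : ι → ℝ) (hx : ∀ i, x i ≠ 0) (s : ℝ) (hs : 0 < s) :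
    ∫⁻ u : ι → ℝ, ENNReal.ofReal (bsGauss (u * x)) * ENNReal.ofReal ((∏ i, |u i|) ^ (s - 1))
      = ENNReal.ofReal ((π ^ (-s / 2) * Gamma (s / 2)) ^ (Fintype.card ι)) *
        ENNReal.ofReal ((∏ i, |x i|) ^ (-s)) := by
  have h0 : 0 ≤ π ^ (-s / 2) * Gamma (s / 2) := by
    have := Real.Gamma_pos_of_pos (half_pos hs); positivity
  have := bs_lintegral_prod (fun i u => rexp (-(π * (u * x i) ^ 2)) * |u| ^ (s - 1))
    (fun i => (bs_gamma_int _ s (hx i) hs).1) (fun i u => by positivity)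
  simp_rw [(bs_gamma_int _ s (hx _) hs).2, Finset.prod_mul_distrib] at this
  rw [← ENNReal.ofReal_mul (by positivity), ← Real.finsetProd_rpow _ _ (fun i _ => abs_nonneg _)]
  simp only [Finset.prod_const, Finset.card_univ] at this
  rw [mul_pow, ← this]
  refine lintegral_congr fun u => ?_
  unfold bsGauss
  rw [← ENNReal.ofReal_mul (Finset.prod_nonneg fun i _ => by positivity),
    ← Real.finsetProd_rpow _ _ (fun i _ => abs_nonneg _)]
  rfl

end Analytic

section NF
open MeasureTheory ENNReal NumberField.InfinitePlace NumberField.mixedEmbedding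
  NumberField.mixedEmbedding.fundamentalCone NumberField.Units
open scoped Classical nonZeroDivisors

variable {K : Type*} [Field K] [NumberField K]

theorem bs_isEmpty (htr : ∀ v : InfinitePlace K, v.IsReal) :
    IsEmpty {w : InfinitePlace K // IsComplex w} :=
  ⟨fun w => not_isReal_iff_isComplex.2 w.2 (htr w.1)⟩

theorem bs_mp_fst (htr : ∀ v : InfinitePlace K, v.IsReal) :
    MeasurePreserving (Prod.fst : mixedSpace K → _) volume volume := by
  have := bs_isEmpty htr
  have : IsProbabilityMeasure (volume : Measure ({w : InfinitePlace K // IsComplex w} → ℂ)) := by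
    rw [Measure.volume_pi_eq_dirac 0]; infer_instance
  exact measurePreserving_fst

theorem bs_norm (htr : ∀ v : InfinitePlace K, v.IsReal) (x : mixedSpace K) :
    mixedEmbedding.norm x = ∏ i, |x.1 i| := by
  rw [mixedEmbedding.norm_apply]
  symm
  refine Fintype.prod_equiv (Equiv.subtypeUnivEquiv htr) _ _ fun i => ?_
  simp [Equiv.subtypeUnivEquiv, normAtPlace_apply_of_isReal i.2, mult, i.2]

theorem bs_card (htr : ∀ v : InfinitePlace K, v.IsReal) :
    Fintype.card {w : InfinitePlace K // IsReal w} = Module.finrank ℚ K := by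
  have h := card_add_two_mul_card_eq_rank K
  have := bs_isEmpty htr
  have h2 : nrComplexPlaces K = 0 := Fintype.card_eq_zero
  rw [h2] at h
  exact h

theorem bs_gamma (htr : ∀ v : InfinitePlace K, v.IsReal) (x : mixedSpace K)
    (hx : mixedEmbedding.norm x ≠ 0) (s : ℝ) (hs : 0 < s) :
    ∫⁻ u : mixedSpace K, ENNReal.ofReal (bsGauss (u * x).1) *
        ENNReal.ofReal (mixedEmbedding.norm u ^ (s - 1))
      = ENNReal.ofReal ((π ^ (-s / 2) * Gamma (s / 2)) ^ (Module.finrank ℚ K)) *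
        ENNReal.ofReal (mixedEmbedding.norm x ^ (-s)) := by
  simp_rw [bs_norm htr] at hx ⊢
  have hx' : ∀ i, x.1 i ≠ 0 := by
    intro i hi
    exact hx (Finset.prod_eq_zero (Finset.mem_univ i) (by simp [hi]))
  rw [← bs_card htr, ← bs_gamma_pi x.1 hx' s hs]
  exact (bs_mp_fst htr).lintegral_comp (f := fun u => ENNReal.ofReal (bsGauss (u * x.1)) *
    ENNReal.ofReal ((∏ i, |u i|) ^ (s - 1))) (by unfold bsGauss; fun_prop)

theorem bs_volume_fd (htr : ∀ v : InfinitePlace K, v.IsReal) (J : (Ideal (𝓞 K))⁰) :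
    volume (ZSpan.fundamentalDomain (fractionalIdealLatticeBasis K (FractionalIdeal.mk0 K J)))
      = ENNReal.ofReal (Ideal.absNorm (J : Ideal (𝓞 K)) * √|discr K|) := by
  have := bs_isEmpty htr
  have h2 : nrComplexPlaces K = 0 := Fintype.card_eq_zero
  have h := covolume_idealLattice K (FractionalIdeal.mk0 K J)
  rw [ZLattice.covolume_eq_measure_fundamentalDomain _ _ (fundamentalDomain_idealLattice K _), h2]
    at h
  simp only [FractionalIdeal.coe_mk0, FractionalIdeal.coeIdeal_absNorm, Rat.cast_natCast, pow_zero,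
    mul_one] at h
  rw [← h, measureReal_def, ENNReal.ofReal_toReal]
  · rfl
  exact ((ZSpan.fundamentalDomain_isBounded (fractionalIdealLatticeBasis K
    (FractionalIdeal.mk0 K J))).measure_lt_top (μ := volume)).ne

theorem bs_theta (htr : ∀ v : InfinitePlace K, v.IsReal) (J : (Ideal (𝓞 K))⁰)
    (u : mixedSpace K) (hu : mixedEmbedding.norm u ≠ 0) :
    ENNReal.ofReal (mixedEmbedding.norm u)⁻¹ ≤
      ENNReal.ofReal (Ideal.absNorm (J : Ideal (𝓞 K)) * √|discr K|) *
      ∑' x : idealLattice K (FractionalIdeal.mk0 K J),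
        ENNReal.ofReal (bsGauss (u * (x : mixedSpace K)).1) := by
  rw [← bs_volume_fd htr]
  simp_rw [bs_norm htr] at hu ⊢
  have hu' : ∀ i, u.1 i ≠ 0 := by
    intro i hi
    exact hu (Finset.prod_eq_zero (Finset.mem_univ i) (by simp [hi]))
  exact bs_theta_pi volume (AddMonoidHom.fst _ _) (bs_mp_fst htr)
    (idealLattice K (FractionalIdeal.mk0 K J)) _
    (fundamentalDomain_idealLattice K _) u.1 hu'

theorem bs_unit_count (u : mixedSpace K) (hu : mixedEmbedding.norm u ≠ 0) :
    ∑' ε : (𝓞 K)ˣ, (fundamentalCone K).indicator (1 : mixedSpace K → ℝ≥0∞) (ε • u) = torsionOrder K := by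
  obtain ⟨ε₀, h₀⟩ := exists_unit_smul_mem hu
  rw [← (Equiv.mulRight ε₀).tsum_eq]
  have : ∀ ε : (𝓞 K)ˣ, (fundamentalCone K).indicator (1 : mixedSpace K → ℝ≥0∞) (Equiv.mulRight ε₀ ε • u)
      = (torsion K : Set (𝓞 K)ˣ).indicator (fun _ => 1) ε := by
    intro ε
    simp only [Equiv.coe_mulRight, mul_smul, Set.indicator_apply, unit_smul_mem_iff_mem_torsion h₀,
      SetLike.mem_coe]
    rfl
  simp_rw [this]
  rw [← tsum_subtype]
  rw [ENNReal.tsum_const]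
  simp [torsionOrder, ENat.card_eq_coe_natCard]

theorem bs_unit_mp (htr : ∀ v : InfinitePlace K, v.IsReal) (ε : (𝓞 K)ˣ) (f : mixedSpace K → ℝ≥0∞)
    (hf : Measurable f) : ∫⁻ u, f (ε • u) = ∫⁻ u, f u := by
  have := bs_isEmpty htr
  have key : ∀ g : mixedSpace K → ℝ≥0∞, Measurable g → ∫⁻ u, g u = ∫⁻ a, g (a, 0) := by
    intro g hg
    rw [← (bs_mp_fst htr).lintegral_comp (f := fun a => g (a, 0)) (hg.comp (by fun_prop))]
    refine lintegral_congr fun u => ?_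
    congr 1
    exact Prod.ext rfl (Subsingleton.elim _ _)
  have hm : Measurable fun u : mixedSpace K => ε • u := by
    simp_rw [unitSMul_smul]
    exact (continuous_const.mul continuous_id).measurable
  rw [key _ hf, key (fun u => f (ε • u)) (hf.comp hm)]
  set D := (mixedEmbedding K (ε : K)).1 with hD
  have hdet : |(Matrix.diagonal D).det| = 1 := by
    rw [Matrix.det_diagonal, Finset.abs_prod, ← bs_norm htr, mixedEmbedding.norm_unit]
  have h := Real.smul_map_diagonal_volume_pi (D := D) (by
    intro h; rw [h] at hdet; simp at hdet)
  rw [hdet, ENNReal.ofReal_one, one_smul] at h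
  conv_rhs => rw [← h]
  have hm2 : Measurable fun a : {w : InfinitePlace K // IsReal w} → ℝ =>
      f (a, 0) := hf.comp (by fun_prop)
  rw [lintegral_map hm2 (by exact (Matrix.toLin' (Matrix.diagonal D)).continuous_of_finiteDimensional.measurable)]
  refine lintegral_congr fun a => ?_
  congr 1
  refine Prod.ext ?_ (Subsingleton.elim _ _)
  ext i
  simp [unitSMul_smul, Matrix.mulVec_diagonal, hD]

theorem bs_torsion (htr : ∀ v : InfinitePlace K, v.IsReal) : torsionOrder K = 2 := by
  have key : ∀ x : torsion K, (x : (𝓞 K)ˣ) = 1 ∨ (x : (𝓞 K)ˣ) = -1 := by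
    intro x
    obtain ⟨v⟩ := (inferInstance : Nonempty (InfinitePlace K))
    have h1 : v ((x : (𝓞 K)ˣ) : K) = 1 := (mem_torsion K).1 x.2 v
    rw [← norm_embedding_of_isReal (htr v), Real.norm_eq_abs] at h1
    have h2 : Function.Injective (embedding_of_isReal (htr v)) := RingHom.injective _
    rcases eq_or_eq_neg_of_abs_eq h1 with h | h
    · left
      ext
      exact h2 (by simpa using h)
    · right
      ext
      exact h2 (by simpa using h)
  let := Fintype.ofFinite (torsion K)
  rw [torsionOrder, Nat.card_eq_fintype_card]
  refine (Finset.card_eq_two.2 ⟨1, ⟨-1, neg_one_mem_torsion⟩,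
    by simp [← Subtype.coe_ne_coe], Finset.ext fun x ↦ ⟨fun _ ↦ ?_, fun _ ↦ Finset.mem_univ _⟩⟩)
  rw [Finset.mem_insert, Finset.mem_singleton, ← Subtype.val_inj, ← Subtype.val_inj]
  exact key x

end NF

section NF2
open MeasureTheory ENNReal NumberField.InfinitePlace NumberField.mixedEmbedding
  NumberField.mixedEmbedding.fundamentalCone NumberField.Units
open scoped Classical nonZeroDivisors

variable {K : Type*} [Field K] [NumberField K]

theorem bs_unit_smul_mem (J : (Ideal (𝓞 K))⁰) (ε : (𝓞 K)ˣ) (x : mixedSpace K)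
    (hx : x ∈ idealLattice K (FractionalIdeal.mk0 K J)) :
    ε • x ∈ idealLattice K (FractionalIdeal.mk0 K J) := by
  rw [mem_idealLattice] at hx ⊢
  obtain ⟨y, hy, rfl⟩ := hx
  refine ⟨(ε : 𝓞 K) • y, ?_, ?_⟩
  · exact Submodule.smul_mem (FractionalIdeal.mk0 K J : FractionalIdeal (𝓞 K)⁰ K).1 _ hy
  · rw [unitSMul_smul, ← map_mul]; rfl

/-- The permutation of an ideal lattice induced by a unit. -/
noncomputable def bsUnitPerm (J : (Ideal (𝓞 K))⁰) (ε : (𝓞 K)ˣ) :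
    idealLattice K (FractionalIdeal.mk0 K J) ≃ idealLattice K (FractionalIdeal.mk0 K J) where
  toFun x := ⟨ε • (x : mixedSpace K), bs_unit_smul_mem J ε x x.2⟩
  invFun x := ⟨ε⁻¹ • (x : mixedSpace K), bs_unit_smul_mem J ε⁻¹ x x.2⟩
  left_inv _ := Subtype.ext (inv_smul_smul ε _)
  right_inv _ := Subtype.ext (smul_inv_smul ε _)

theorem bs_norm_ne_zero (J : (Ideal (𝓞 K))⁰) (x : mixedSpace K)
    (hx : x ∈ idealLattice K (FractionalIdeal.mk0 K J)) (h0 : x ≠ 0) :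
    mixedEmbedding.norm x ≠ 0 := by
  rw [mem_idealLattice] at hx
  obtain ⟨y, hy, rfl⟩ := hx
  rw [ne_eq, norm_eq_zero_iff' ⟨y, rfl⟩]
  exact h0

/-- The Mellin integrand. -/
noncomputable def bsPhi (s : ℝ) (x u : mixedSpace K) : ℝ≥0∞ :=
  ENNReal.ofReal (bsGauss (u * x).1) * ENNReal.ofReal (mixedEmbedding.norm u ^ (s - 1))

theorem bs_measurable_norm : Measurable (mixedEmbedding.norm : mixedSpace K → ℝ) :=
  (mixedEmbedding.continuous_norm K).measurable

theorem bs_measurable_gauss (x : mixedSpace K) :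
    Measurable fun u : mixedSpace K => ENNReal.ofReal (bsGauss (u * x).1) := by
  unfold bsGauss
  simp only [Prod.fst_mul, Pi.mul_apply]
  fun_prop

theorem bs_measurable_phi (s : ℝ) (x : mixedSpace K) : Measurable (bsPhi s x) :=
  (bs_measurable_gauss x).mul (bs_measurable_norm.pow_const (s - 1)).ennreal_ofReal

theorem bs_unfold1 (htr : ∀ v : InfinitePlace K, v.IsReal) (s : ℝ) (hs : 1 < s)
    (x : mixedSpace K) :
    (torsionOrder K : ℝ≥0∞) * ∫⁻ u, bsPhi s x u
      = ∑' ε : (𝓞 K)ˣ, ∫⁻ u in fundamentalCone K, bsPhi s (ε • x) u := by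
  have hmS : ∀ ε : (𝓞 K)ˣ, Measurable fun u : mixedSpace K => ε • u := by
    intro ε
    simp_rw [unitSMul_smul]
    exact (continuous_const.mul continuous_id).measurable
  have hmI : Measurable ((fundamentalCone K).indicator (1 : mixedSpace K → ℝ≥0∞)) :=
    measurable_one.indicator (measurableSet_fundamentalCone K)
  have h1 : (torsionOrder K : ℝ≥0∞) * ∫⁻ u, bsPhi s x u = ∫⁻ u, ∑' ε : (𝓞 K)ˣ,
      (fundamentalCone K).indicator (1 : mixedSpace K → ℝ≥0∞) (ε • u) * bsPhi s x u := by
    rw [← lintegral_const_mul _ (bs_measurable_phi s x)]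
    refine lintegral_congr fun u => ?_
    rw [ENNReal.tsum_mul_right]
    by_cases hu : mixedEmbedding.norm u = 0
    · have : bsPhi s x u = 0 := by
        simp [bsPhi, hu, Real.zero_rpow (by linarith : s - 1 ≠ 0)]
      simp [this]
    · rw [bs_unit_count u hu]
  have hc1 : Countable K := by
    have b := Module.finBasis ℚ K
    exact b.equivFun.toEquiv.countable_iff.2 inferInstance
  have hc2 : Countable (𝓞 K) := Subtype.coe_injective.countable
  have hc3 : Countable (𝓞 K)ˣ := (Units.val_injective (α := 𝓞 K)).countable
  rw [h1, lintegral_tsum fun ε => by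
    exact ((hmI.comp (hmS ε)).mul (bs_measurable_phi s x)).aemeasurable,
    ← (Equiv.inv (𝓞 K)ˣ).tsum_eq]
  refine tsum_congr fun ε => ?_
  rw [← bs_unit_mp htr ε _ (by exact (hmI.comp (hmS _)).mul (bs_measurable_phi s x))]
  rw [← lintegral_indicator (measurableSet_fundamentalCone K)]
  refine lintegral_congr fun u => ?_
  simp only [Equiv.inv_apply, inv_smul_smul]
  have : bsPhi s x (ε • u) = bsPhi s (ε • x) u := by
    unfold bsPhi
    rw [norm_unit_smul, unitSMul_smul, unitSMul_smul]
    congr 4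
    ring
  rw [this]
  by_cases hu : u ∈ fundamentalCone K <;> simp [hu]

theorem bs_unfold2 (htr : ∀ v : InfinitePlace K, v.IsReal) (s : ℝ) (hs : 1 < s)
    (J : (Ideal (𝓞 K))⁰) :
    ∑' x : idealLattice K (FractionalIdeal.mk0 K J),
      (fundamentalCone K).indicator (1 : mixedSpace K → ℝ≥0∞) x * ∫⁻ u, bsPhi s (x : mixedSpace K) u
      = ∑' x : idealLattice K (FractionalIdeal.mk0 K J),
        if x = 0 then 0 else ∫⁻ u in fundamentalCone K, bsPhi s (x : mixedSpace K) u := by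
  have hw : (torsionOrder K : ℝ≥0∞) ≠ 0 := by exact_mod_cast torsionOrder_ne_zero K
  rw [← ENNReal.mul_right_inj hw (ENNReal.natCast_ne_top _), ← ENNReal.tsum_mul_left,
    ← ENNReal.tsum_mul_left]
  simp_rw [mul_left_comm _ ((fundamentalCone K).indicator _ _), bs_unfold1 htr s hs,
    ← ENNReal.tsum_mul_left]
  rw [ENNReal.tsum_comm]
  have : ∀ ε : (𝓞 K)ˣ, ∑' x : idealLattice K (FractionalIdeal.mk0 K J),
      (fundamentalCone K).indicator (1 : mixedSpace K → ℝ≥0∞) x *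
        ∫⁻ u in fundamentalCone K, bsPhi s (ε • (x : mixedSpace K)) u
      = ∑' x : idealLattice K (FractionalIdeal.mk0 K J),
      (fundamentalCone K).indicator (1 : mixedSpace K → ℝ≥0∞) (ε⁻¹ • (x : mixedSpace K)) *
        ∫⁻ u in fundamentalCone K, bsPhi s (x : mixedSpace K) u := by
    intro ε
    rw [← (bsUnitPerm J ε).tsum_eq (fun x : idealLattice K (FractionalIdeal.mk0 K J) =>
      (fundamentalCone K).indicator (1 : mixedSpace K → ℝ≥0∞) (ε⁻¹ • (x : mixedSpace K)) *
        ∫⁻ u in fundamentalCone K, bsPhi s (x : mixedSpace K) u)]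
    refine tsum_congr fun x => ?_
    simp only [bsUnitPerm, Equiv.coe_fn_mk, inv_smul_smul]
  simp_rw [this]
  rw [ENNReal.tsum_comm]
  refine tsum_congr fun x => ?_
  have h := (Equiv.inv (𝓞 K)ˣ).tsum_eq
    (fun ε => (fundamentalCone K).indicator (1 : mixedSpace K → ℝ≥0∞) (ε • (x : mixedSpace K)))
  simp only [Equiv.inv_apply] at h
  rw [ENNReal.tsum_mul_right, h]
  by_cases hx : x = 0
  · subst hx
    have : (0 : mixedSpace K) ∉ fundamentalCone K := by
      intro h
      exact h.2 (map_zero _)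
    simp [this]
  · rw [bs_unit_count _ (bs_norm_ne_zero J x x.2 (by simpa using hx)), if_neg hx]

theorem bs_unfold (htr : ∀ v : InfinitePlace K, v.IsReal) (s : ℝ) (hs : 1 < s)
    (J : (Ideal (𝓞 K))⁰) :
    ∫⁻ u in fundamentalCone K,
      (ENNReal.ofReal ((Ideal.absNorm (J : Ideal (𝓞 K)) * √|discr K|)⁻¹ * (mixedEmbedding.norm u)⁻¹) - 1)
        * ENNReal.ofReal (mixedEmbedding.norm u ^ (s - 1)) ≤
    ENNReal.ofReal ((π ^ (-s / 2) * Gamma (s / 2)) ^ (Module.finrank ℚ K)) *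
    ∑' x : idealLattice K (FractionalIdeal.mk0 K J),
      (fundamentalCone K).indicator (1 : mixedSpace K → ℝ≥0∞) x *
        ENNReal.ofReal (mixedEmbedding.norm (x : mixedSpace K) ^ (-s)) := by
  have h1 : ENNReal.ofReal ((π ^ (-s / 2) * Gamma (s / 2)) ^ (Module.finrank ℚ K)) *
    ∑' x : idealLattice K (FractionalIdeal.mk0 K J),
      (fundamentalCone K).indicator (1 : mixedSpace K → ℝ≥0∞) x *
        ENNReal.ofReal (mixedEmbedding.norm (x : mixedSpace K) ^ (-s)) =
      ∑' x : idealLattice K (FractionalIdeal.mk0 K J),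
      (fundamentalCone K).indicator (1 : mixedSpace K → ℝ≥0∞) x *
        ∫⁻ u, bsPhi s (x : mixedSpace K) u := by
    rw [← ENNReal.tsum_mul_left]
    refine tsum_congr fun x => ?_
    by_cases hx : (x : mixedSpace K) ∈ fundamentalCone K
    · unfold bsPhi
      rw [bs_gamma htr _ (norm_pos_of_mem hx).ne' s (by linarith), mul_left_comm]
    · simp [hx]
  have h2 : ∀ x : idealLattice K (FractionalIdeal.mk0 K J),
      (if x = 0 then 0 else ∫⁻ u in fundamentalCone K, bsPhi s (x : mixedSpace K) u)
      = ∫⁻ u in fundamentalCone K, if x = 0 then 0 else bsPhi s (x : mixedSpace K) u := by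
    intro x; split_ifs <;> simp
  rw [h1, bs_unfold2 htr s hs J]
  simp_rw [h2]
  rw [← lintegral_tsum (fun x => by
    split_ifs
    · exact aemeasurable_const
    · exact (bs_measurable_phi s _).aemeasurable)]
  refine setLIntegral_mono' (measurableSet_fundamentalCone K) fun u hu => ?_
  have hu0 := norm_pos_of_mem hu
  set c : ℝ := Ideal.absNorm (J : Ideal (𝓞 K)) * √|discr K| with hc
  have hcpos : 0 < c := by
    have h1 : 0 < Ideal.absNorm (J : Ideal (𝓞 K)) := Ideal.absNorm_pos_of_nonZeroDivisors J
    have h2 : (0 : ℝ) < |(discr K : ℝ)| := abs_pos.2 (Int.cast_ne_zero.2 (discr_ne_zero K))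
    positivity
  have hth := bs_theta htr J u hu0.ne'
  rw [← hc] at hth
  have h3 : ENNReal.ofReal (c⁻¹ * (mixedEmbedding.norm u)⁻¹) ≤
      ∑' x : idealLattice K (FractionalIdeal.mk0 K J),
        ENNReal.ofReal (bsGauss (u * (x : mixedSpace K)).1) := by
    rw [ENNReal.ofReal_mul (by positivity)]
    calc _ ≤ _ := mul_le_mul_right hth _
      _ = _ := by
        rw [← mul_assoc, ← ENNReal.ofReal_mul (by positivity), inv_mul_cancel₀ hcpos.ne',
          ENNReal.ofReal_one, one_mul]
  have h4 : ∀ x : idealLattice K (FractionalIdeal.mk0 K J),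
      (if x = 0 then 0 else bsPhi s (x : mixedSpace K) u) =
      (if x = 0 then 0 else ENNReal.ofReal (bsGauss (u * (x : mixedSpace K)).1)) *
        ENNReal.ofReal (mixedEmbedding.norm u ^ (s - 1)) := by
    intro x; split_ifs <;> simp [bsPhi]
  simp_rw [h4]
  rw [ENNReal.tsum_mul_right]
  gcongr
  rw [tsub_le_iff_left]
  refine h3.trans ?_
  rw [ENNReal.tsum_eq_add_tsum_ite (0 : idealLattice K (FractionalIdeal.mk0 K J))]
  exact add_le_add (by simp [bsGauss]) (le_of_eq (tsum_congr fun x => by split_ifs <;> rfl))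

end NF2

section NF3
open MeasureTheory ENNReal NumberField.InfinitePlace NumberField.mixedEmbedding
  NumberField.mixedEmbedding.fundamentalCone NumberField.Units
open scoped Classical nonZeroDivisors Pointwise

variable {K : Type*} [Field K] [NumberField K]

theorem bs_lattice_sum1 (s : ℝ) (J : (Ideal (𝓞 K))⁰) :
    ∑' x : idealLattice K (FractionalIdeal.mk0 K J),
      (fundamentalCone K).indicator (1 : mixedSpace K → ℝ≥0∞) x *
        ENNReal.ofReal (mixedEmbedding.norm (x : mixedSpace K) ^ (-s))
    = ∑' a : idealSet K J, ENNReal.ofReal (mixedEmbedding.norm (a : mixedSpace K) ^ (-s)) := by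
  have h1 := tsum_subtype (idealSet K J)
    (fun a => ENNReal.ofReal (mixedEmbedding.norm (a : mixedSpace K) ^ (-s)))
  have h2 := tsum_subtype ((idealLattice K (FractionalIdeal.mk0 K J)) : Set (mixedSpace K))
    (fun x => (fundamentalCone K).indicator (1 : mixedSpace K → ℝ≥0∞) x *
        ENNReal.ofReal (mixedEmbedding.norm (x : mixedSpace K) ^ (-s)))
  refine Eq.trans ?_ (h2.trans (Eq.trans ?_ h1.symm))
  · rfl
  · refine tsum_congr fun x => ?_
    simp only [Set.indicator_apply, idealSet, Set.mem_inter_iff]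
    split_ifs <;> simp_all

/-- Elements of the ideal set versus pairs (principal ideal, root of unity). -/
noncomputable def bsEquiv (J : (Ideal (𝓞 K))⁰) :
    {e : idealSet K J ≃ {I : (Ideal (𝓞 K))⁰ // (J : Ideal (𝓞 K)) ∣ I ∧
      (I : Ideal (𝓞 K)).IsPrincipal} × (torsion K) //
      ∀ a, (Ideal.absNorm ((e a).1.1 : Ideal (𝓞 K)) : ℝ) = mixedEmbedding.norm (a : mixedSpace K)} := by
  let g : {I : (Ideal (𝓞 K))⁰ // (J : Ideal (𝓞 K)) ∣ I ∧
      (I : Ideal (𝓞 K)).IsPrincipal} × (torsion K) → ℕ := fun p => Ideal.absNorm (p.1.1 : Ideal (𝓞 K))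
  let f : idealSet K J → ℕ := fun a => intNorm (idealSetEquiv K J a).1
  have hf : ∀ a, (f a : ℝ) = mixedEmbedding.norm (a : mixedSpace K) := fun a =>
    intNorm_idealSetEquiv_apply a
  have e : ∀ n, {a // f a = n} ≃ {p // g p = n} := fun n =>
    calc {a // f a = n} ≃ {a : idealSet K J // mixedEmbedding.norm (a : mixedSpace K) = n} :=
          Equiv.subtypeEquivRight fun a => by rw [← hf, Nat.cast_inj]
      _ ≃ {I : (Ideal (𝓞 K))⁰ // (J : Ideal (𝓞 K)) ∣ I ∧ (I : Ideal (𝓞 K)).IsPrincipal ∧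
            Ideal.absNorm (I : Ideal (𝓞 K)) = n} × torsion K := idealSetEquivNorm K J n
      _ ≃ {I : (Ideal (𝓞 K))⁰ // ((J : Ideal (𝓞 K)) ∣ I ∧ (I : Ideal (𝓞 K)).IsPrincipal) ∧
            Ideal.absNorm (I : Ideal (𝓞 K)) = n} × torsion K :=
          Equiv.prodCongrLeft fun _ => Equiv.subtypeEquivRight fun _ => and_assoc.symm
      _ ≃ {I : {I : (Ideal (𝓞 K))⁰ // (J : Ideal (𝓞 K)) ∣ I ∧ (I : Ideal (𝓞 K)).IsPrincipal} //
            Ideal.absNorm (I.1 : Ideal (𝓞 K)) = n} × torsion K :=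
          Equiv.prodCongrLeft fun _ => (Equiv.subtypeSubtypeEquivSubtypeInter
            (fun I : (Ideal (𝓞 K))⁰ => (J : Ideal (𝓞 K)) ∣ I ∧ (I : Ideal (𝓞 K)).IsPrincipal)
            (fun I => Ideal.absNorm (I : Ideal (𝓞 K)) = n)).symm
      _ ≃ {p // g p = n} := (Equiv.prodSubtypeFstEquivSubtypeProd
            (p := fun I : {I : (Ideal (𝓞 K))⁰ // (J : Ideal (𝓞 K)) ∣ I ∧
              (I : Ideal (𝓞 K)).IsPrincipal} => Ideal.absNorm (I.1 : Ideal (𝓞 K)) = n)).symm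
  refine ⟨Equiv.ofFiberEquiv e, fun a => ?_⟩
  have := Equiv.ofFiberEquiv_map e a
  rw [← hf, ← this]

theorem bs_lattice_sum2 (s : ℝ) (J : (Ideal (𝓞 K))⁰) :
    ∑' a : idealSet K J, ENNReal.ofReal (mixedEmbedding.norm (a : mixedSpace K) ^ (-s))
    = torsionOrder K * ∑' I : {I : (Ideal (𝓞 K))⁰ // (J : Ideal (𝓞 K)) ∣ I ∧
      (I : Ideal (𝓞 K)).IsPrincipal},
        ENNReal.ofReal ((Ideal.absNorm (I.1 : Ideal (𝓞 K)) : ℝ) ^ (-s)) := by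
  obtain ⟨e, he⟩ := bsEquiv J
  simp_rw [← he]
  rw [e.tsum_eq (fun p => ENNReal.ofReal ((Ideal.absNorm (p.1.1 : Ideal (𝓞 K)) : ℝ) ^ (-s))),
    ENNReal.tsum_prod (f := fun (I : {I : (Ideal (𝓞 K))⁰ // (J : Ideal (𝓞 K)) ∣ I ∧
      (I : Ideal (𝓞 K)).IsPrincipal}) (_ : torsion K) =>
        ENNReal.ofReal ((Ideal.absNorm (I.1 : Ideal (𝓞 K)) : ℝ) ^ (-s))), ← ENNReal.tsum_mul_left]
  refine tsum_congr fun I => ?_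
  have : Fintype (torsion K) := Fintype.ofFinite _
  rw [tsum_fintype, Finset.sum_const, nsmul_eq_mul, Finset.card_univ, torsionOrder,
    ← Nat.card_eq_fintype_card]

theorem bs_lattice_sum3 (s : ℝ) (J : (Ideal (𝓞 K))⁰) (C : ClassGroup (𝓞 K))
    (hJ : ClassGroup.mk0 J = C⁻¹) :
    ∑' I : {I : (Ideal (𝓞 K))⁰ // (J : Ideal (𝓞 K)) ∣ I ∧ (I : Ideal (𝓞 K)).IsPrincipal},
        ENNReal.ofReal ((Ideal.absNorm (I.1 : Ideal (𝓞 K)) : ℝ) ^ (-s))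
    = ENNReal.ofReal ((Ideal.absNorm (J : Ideal (𝓞 K)) : ℝ) ^ (-s)) *
      ∑' I : {I : (Ideal (𝓞 K))⁰ // ClassGroup.mk0 I = C},
        ENNReal.ofReal ((Ideal.absNorm (I.1 : Ideal (𝓞 K)) : ℝ) ^ (-s)) := by
  have key : ∀ I : (Ideal (𝓞 K))⁰, (((J * I : (Ideal (𝓞 K))⁰) : Ideal (𝓞 K)).IsPrincipal ↔
      ClassGroup.mk0 I = C) := by
    intro I
    rw [← ClassGroup.mk0_eq_one_iff (J * I).2]
    change ClassGroup.mk0 (J * I) = 1 ↔ _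
    rw [map_mul, hJ, inv_mul_eq_one, eq_comm]
  let φ : {I : (Ideal (𝓞 K))⁰ // ClassGroup.mk0 I = C} →
      {I : (Ideal (𝓞 K))⁰ // (J : Ideal (𝓞 K)) ∣ I ∧ (I : Ideal (𝓞 K)).IsPrincipal} :=
    fun I => ⟨J * I.1, ⟨(I.1 : Ideal (𝓞 K)), rfl⟩, (key I.1).2 I.2⟩
  have hφ : Function.Bijective φ := by
    constructor
    · intro a b h
      have h1 : J * a.1 = J * b.1 := congrArg Subtype.val h
      exact Subtype.ext (mul_left_cancel h1)
    · rintro ⟨I, ⟨I', hI'⟩, hp⟩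
      have hI0 : I' ∈ (Ideal (𝓞 K))⁰ := by
        rw [mem_nonZeroDivisors_iff_ne_zero]
        rintro rfl
        exact nonZeroDivisors.ne_zero I.2 (by rw [hI', mul_zero])
      have hI : I = J * ⟨I', hI0⟩ := Subtype.ext hI'
      subst hI
      exact ⟨⟨⟨I', hI0⟩, (key _).1 hp⟩, rfl⟩
  rw [← (Equiv.ofBijective φ hφ).tsum_eq, ← ENNReal.tsum_mul_left]
  refine tsum_congr fun I => ?_
  rw [← ENNReal.ofReal_mul (by positivity), ← Real.mul_rpow (by positivity) (by positivity)]
  simp [φ, Equiv.ofBijective]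

theorem bs_vol (htr : ∀ v : InfinitePlace K, v.IsReal) (v : ℝ) (hv : 0 < v) :
    volume (fundamentalCone K ∩ {x | mixedEmbedding.norm x ≤ v}) =
      ENNReal.ofReal (2 ^ (Module.finrank ℚ K) * regulator K * v) := by
  set d := Module.finrank ℚ K with hd
  have hd0 : d ≠ 0 := Module.finrank_pos.ne'
  set r : ℝ := v ^ ((d : ℝ)⁻¹) with hr
  have hr0 : 0 < r := Real.rpow_pos_of_pos hv _
  have hrd : r ^ d = v := Real.rpow_inv_natCast_pow hv.le hd0
  have h1 : fundamentalCone K ∩ {x | mixedEmbedding.norm x ≤ v} = r • normLeOne K := by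
    ext x
    rw [Set.mem_smul_set_iff_inv_smul_mem₀ hr0.ne', Set.mem_inter_iff, Set.mem_inter_iff,
      smul_mem_iff_mem (inv_ne_zero hr0.ne')]
    simp only [Set.mem_ofPred_eq, mixedEmbedding.norm_smul, abs_inv, abs_of_pos hr0, inv_pow, ← hd,
      hrd]
    rw [inv_mul_le_iff₀ hv, mul_one]
  have := bs_isEmpty htr
  have h2 : nrComplexPlaces K = 0 := Fintype.card_eq_zero
  have h3 : nrRealPlaces K = d := bs_card htr
  rw [h1, Measure.addHaar_smul, mixedEmbedding.finrank, ← hd, hrd, abs_of_pos hv, volume_normLeOne,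
    h2, h3, pow_zero, mul_one, mul_comm, ENNReal.ofReal_mul (by have := regulator_pos K; positivity),
    ENNReal.ofReal_mul (by positivity), ENNReal.ofReal_pow (by norm_num), ENNReal.ofReal_ofNat]

theorem bs_map (htr : ∀ v : InfinitePlace K, v.IsReal) (c : ℝ) (hc : 0 < c) :
    (volume.restrict (fundamentalCone K ∩ {x | mixedEmbedding.norm x ≤ c})).map mixedEmbedding.norm
     = ENNReal.ofReal (2 ^ (Module.finrank ℚ K) * regulator K) • volume.restrict (Set.Ioc 0 c) := by
  have hR := regulator_pos K
  have : IsFiniteMeasure ((volume.restrict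
      (fundamentalCone K ∩ {x | mixedEmbedding.norm x ≤ c})).map mixedEmbedding.norm) := by
    have : IsFiniteMeasure (volume.restrict
      (fundamentalCone K ∩ {x | mixedEmbedding.norm x ≤ c})) :=
      ⟨by rw [Measure.restrict_apply_univ, bs_vol htr c hc]; exact ENNReal.ofReal_lt_top⟩
    infer_instance
  refine Measure.ext_of_Iic _ _ fun a => ?_
  rw [Measure.map_apply bs_measurable_norm measurableSet_Iic,
    Measure.restrict_apply (bs_measurable_norm measurableSet_Iic), Measure.smul_apply,
    Measure.restrict_apply measurableSet_Iic, smul_eq_mul]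
  have h1 : (mixedEmbedding.norm ⁻¹' Set.Iic a) ∩
      (fundamentalCone K ∩ {x | mixedEmbedding.norm x ≤ c}) =
      fundamentalCone K ∩ {x | mixedEmbedding.norm x ≤ min a c} := by
    ext x
    simp only [Set.mem_inter_iff, Set.mem_preimage, Set.mem_Iic, Set.mem_ofPred_eq, le_min_iff]
    tauto
  have h2 : Set.Iic a ∩ Set.Ioc 0 c = Set.Ioc 0 (min a c) := by
    ext x
    simp only [Set.mem_inter_iff, Set.mem_Iic, Set.mem_Ioc, le_min_iff]
    tauto
  rw [h1, h2, Real.volume_Ioc, sub_zero]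
  rcases lt_or_ge 0 (min a c) with h | h
  · rw [bs_vol htr _ h, ENNReal.ofReal_mul (by positivity)]
  · rw [ENNReal.ofReal_of_nonpos h, mul_zero]
    convert measure_empty (μ := (volume : Measure (mixedSpace K)))
    ext x
    simp only [Set.mem_inter_iff, Set.mem_ofPred_eq, Set.mem_empty_iff_false, iff_false, not_and,
      not_le]
    intro hx
    exact h.trans_lt (norm_pos_of_mem hx)

theorem bs_one_dim (s : ℝ) (hs : 1 < s) (c : ℝ) (hc : 0 < c) :
    ENNReal.ofReal (c ^ s / (s * (s - 1))) = ∫⁻ v in Set.Ioc 0 c,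
      (ENNReal.ofReal (c * v⁻¹) - 1) * ENNReal.ofReal (v ^ (s - 1)) := by
  have i1 : IntervalIntegrable (fun v : ℝ => v ^ (s - 2)) volume 0 c :=
    intervalIntegral.intervalIntegrable_rpow' (by linarith)
  have i2 : IntervalIntegrable (fun v : ℝ => v ^ (s - 1)) volume 0 c :=
    intervalIntegral.intervalIntegrable_rpow' (by linarith)
  have h1 : ∫ v in (0:ℝ)..c, (c * v ^ (s - 2) - v ^ (s - 1)) = c ^ s / (s * (s - 1)) := by
    rw [intervalIntegral.integral_sub (i1.const_mul c) i2, intervalIntegral.integral_const_mul,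
      integral_rpow (Or.inl (by linarith)), integral_rpow (Or.inl (by linarith)),
      Real.zero_rpow (by linarith), Real.zero_rpow (by linarith)]
    have e1 : s - 2 + 1 = s - 1 := by ring
    have e2 : s - 1 + 1 = s := by ring
    have e3 : c * c ^ (s - 1) = c ^ s := by
      rw [Real.rpow_sub_one hc.ne']; field_simp
    rw [e1, e2, sub_zero, sub_zero, ← mul_div_assoc, e3]
    have : s - 1 ≠ 0 := by linarith
    have : s ≠ 0 := by linarith
    field_simp
    ring
  have heq : ∀ v ∈ Set.Ioc 0 c, c * v ^ (s - 2) - v ^ (s - 1) = (c * v⁻¹ - 1) * v ^ (s - 1) := by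
    intro v hv
    have : v ^ (s - 1) = v ^ (s - 2) * v := by
      rw [← Real.rpow_add_one hv.1.ne']; congr 1; ring
    rw [this]
    have := hv.1.ne'
    field_simp
  rw [← h1, intervalIntegral.integral_of_le hc.le, ofReal_integral_eq_lintegral_ofReal]
  · refine setLIntegral_congr_fun measurableSet_Ioc fun v hv => ?_
    have h3 : 1 ≤ c * v⁻¹ := by
      rw [← div_eq_mul_inv, one_le_div hv.1]; exact hv.2
    simp only [heq v hv]
    rw [ENNReal.ofReal_mul (by linarith), ENNReal.ofReal_sub _ zero_le_one, ENNReal.ofReal_one]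
  · exact (((i1.const_mul c).sub i2).1)
  · refine (ae_restrict_iff' measurableSet_Ioc).2 (Filter.Eventually.of_forall fun v hv => ?_)
    have h3 : 1 ≤ c * v⁻¹ := by
      rw [← div_eq_mul_inv, one_le_div hv.1]; exact hv.2
    simp only [heq v hv, Pi.zero_apply]
    exact mul_nonneg (by linarith) (Real.rpow_nonneg hv.1.le _)

theorem bs_cone_int (htr : ∀ v : InfinitePlace K, v.IsReal) (s : ℝ) (hs : 1 < s)
    (c : ℝ) (hc : 0 < c) :
    ENNReal.ofReal (2 ^ (Module.finrank ℚ K) * regulator K * (c ^ s / (s * (s - 1)))) ≤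
    ∫⁻ u in fundamentalCone K, (ENNReal.ofReal (c * (mixedEmbedding.norm u)⁻¹) - 1)
        * ENNReal.ofReal (mixedEmbedding.norm u ^ (s - 1)) := by
  have hR := regulator_pos K
  refine le_trans ?_ (lintegral_mono_set
    (Set.inter_subset_left (t := {x : mixedSpace K | mixedEmbedding.norm x ≤ c})))
  have hm : Measurable fun v : ℝ =>
      (ENNReal.ofReal (c * v⁻¹) - 1) * ENNReal.ofReal (v ^ (s - 1)) := by
    refine Measurable.mul (Measurable.sub (f := fun v : ℝ => ENNReal.ofReal (c * v⁻¹))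
      (g := fun _ => 1) ?_ measurable_const) ?_
    · fun_prop
    · exact (measurable_id.pow_const _).ennreal_ofReal
  have := lintegral_map (μ := volume.restrict
    (fundamentalCone K ∩ {x | mixedEmbedding.norm x ≤ c})) hm bs_measurable_norm
  rw [← this, bs_map htr c hc, lintegral_smul_measure, ← bs_one_dim s hs c hc,
    ENNReal.ofReal_mul (by positivity), smul_eq_mul]

theorem bs_class (htr : ∀ v : InfinitePlace K, v.IsReal) (s : ℝ) (hs : 1 < s)
    (C : ClassGroup (𝓞 K)) :
    ENNReal.ofReal (2 ^ (Module.finrank ℚ K) * regulator K *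
      ((√|discr K|)⁻¹ ^ s / (s * (s - 1)))) ≤
    ENNReal.ofReal ((π ^ (-s / 2) * Gamma (s / 2)) ^ (Module.finrank ℚ K)) * (2 *
      ∑' I : {I : (Ideal (𝓞 K))⁰ // ClassGroup.mk0 I = C},
        ENNReal.ofReal ((Ideal.absNorm (I.1 : Ideal (𝓞 K)) : ℝ) ^ (-s))) := by
  obtain ⟨J, hJ⟩ := ClassGroup.mk0_surjective C⁻¹
  have hR := regulator_pos K
  have h1 : (0 : ℝ) < Ideal.absNorm (J : Ideal (𝓞 K)) :=
    Nat.cast_pos.2 (Ideal.absNorm_pos_of_nonZeroDivisors J)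
  have h2 : (0 : ℝ) < |(discr K : ℝ)| := abs_pos.2 (Int.cast_ne_zero.2 (discr_ne_zero K))
  have h := (bs_cone_int htr s hs _ (inv_pos.2 (mul_pos h1 (Real.sqrt_pos.2 h2)))).trans
    (bs_unfold htr s hs J)
  rw [bs_lattice_sum1, bs_lattice_sum2, bs_lattice_sum3 s J C hJ, bs_torsion htr] at h
  set N : ℝ := (Ideal.absNorm (J : Ideal (𝓞 K)) : ℝ)
  have e1 : 2 ^ (Module.finrank ℚ K) * regulator K *
      (((N * √|(discr K : ℝ)|)⁻¹) ^ s / (s * (s - 1)))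
      = N ^ (-s) * (2 ^ (Module.finrank ℚ K) * regulator K *
      ((√|(discr K : ℝ)|)⁻¹ ^ s / (s * (s - 1)))) := by
    rw [mul_inv, Real.mul_rpow (by positivity) (by positivity), Real.inv_rpow h1.le,
      ← Real.rpow_neg h1.le]
    ring
  have hN : 0 < N ^ (-s) := Real.rpow_pos_of_pos h1 _
  rw [e1, ENNReal.ofReal_mul hN.le, mul_left_comm _ (ENNReal.ofReal (N ^ (-s))),
    mul_left_comm _ (ENNReal.ofReal (N ^ (-s)))] at h
  exact (ENNReal.mul_le_mul_iff_right (by simpa using hN) ENNReal.ofReal_ne_top).1 h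

theorem bs_total (htr : ∀ v : InfinitePlace K, v.IsReal) (s : ℝ) (hs : 1 < s) :
    (classNumber K : ℝ≥0∞) * ENNReal.ofReal (2 ^ (Module.finrank ℚ K) * regulator K *
      ((√|discr K|)⁻¹ ^ s / (s * (s - 1)))) ≤
    ENNReal.ofReal ((π ^ (-s / 2) * Gamma (s / 2)) ^ (Module.finrank ℚ K)) * (2 *
      ∑' I : (Ideal (𝓞 K))⁰,
        ENNReal.ofReal ((Ideal.absNorm (I : Ideal (𝓞 K)) : ℝ) ^ (-s))) := by
  have h := Finset.sum_le_sum fun C (_ : C ∈ (Finset.univ : Finset (ClassGroup (𝓞 K)))) =>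
    bs_class htr s hs C
  rw [Finset.sum_const, Finset.card_univ, nsmul_eq_mul, ← Finset.mul_sum, ← Finset.mul_sum] at h
  refine h.trans (le_of_eq ?_)
  congr 2
  rw [← (Equiv.sigmaFiberEquiv (fun I : (Ideal (𝓞 K))⁰ => ClassGroup.mk0 I)).tsum_eq,
    ENNReal.tsum_sigma', tsum_fintype]
  rfl

end NF3

section NF4
open MeasureTheory ENNReal NumberField.InfinitePlace NumberField.mixedEmbedding
  NumberField.mixedEmbedding.fundamentalCone NumberField.Units
open scoped Classical nonZeroDivisors

theorem bs_lseries (K : Type*) [Field K] [NumberField K] (s : ℝ) (hs : 1 < s) :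
    LSeriesSummable (fun n : ℕ => (((Nat.card {I : Ideal (𝓞 K) // Ideal.absNorm I = n} : ℕ) : ℝ) : ℂ))
      (s : ℂ) := by
  refine LSeriesSummable_of_sum_norm_bigO_and_nonneg (r := 1) ?_ (fun _ => Nat.cast_nonneg _)
    zero_le_one (by simpa using hs)
  refine Asymptotics.isBigO_atTop_natCast_rpow_of_tendsto_div_rpow
    (a := (2 ^ nrRealPlaces K * (2 * π) ^ nrComplexPlaces K * regulator K * classNumber K) /
            (torsionOrder K * Real.sqrt |discr K|)) ?_
  refine ((NumberField.Ideal.tendsto_norm_le_div_atTop₀ K).comp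
    tendsto_natCast_atTop_atTop).congr fun n ↦ ?_
  simp only [Function.comp_apply, Nat.cast_le, ← Nat.cast_sum, Real.rpow_one]
  congr
  rw [← add_left_inj 1, ← Ideal.card_norm_le_eq_card_norm_le_add_one,
    show Finset.Icc 1 n = Finset.Ioc 0 n from Finset.Icc_succ_left_eq_Ioc _ _,
    show 1 = Nat.card {I : Ideal (𝓞 K) // Ideal.absNorm I = 0} by simp [Ideal.absNorm_eq_zero_iff],
    Finset.sum_Ioc_add_eq_sum_Icc (n.zero_le),
    ← Finset.card_preimage_eq_sum_card_image_eq (fun k _ ↦ Ideal.finite_setOfPred_absNorm_eq k)]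
  simp [Set.coe_eq_subtype]

theorem bs_summable (K : Type*) [Field K] [NumberField K] (s : ℝ) (hs : 1 < s) :
    Summable fun I : {I : Ideal (𝓞 K) // I ≠ ⊥} =>
      ((Ideal.absNorm (I : Ideal (𝓞 K)) : ℝ)) ^ (-s) := by
  have h : Summable fun I : Ideal (𝓞 K) => ((Ideal.absNorm I : ℝ)) ^ (-s) := by
    rw [← (Equiv.sigmaFiberEquiv (fun I : Ideal (𝓞 K) => Ideal.absNorm I)).summable_iff,
      summable_sigma_of_nonneg (fun _ => by simp only [Function.comp_apply]; positivity)]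
    have hfin : ∀ n : ℕ, Finite {I : Ideal (𝓞 K) // Ideal.absNorm I = n} := fun n =>
      (Ideal.finite_setOfPred_absNorm_eq n).to_subtype
    constructor
    · intro n
      have := hfin n
      exact Summable.of_finite
    · refine (bs_lseries K s hs).norm.congr fun n => ?_
      have := hfin n
      have : Fintype {I : Ideal (𝓞 K) // Ideal.absNorm I = n} := Fintype.ofFinite _
      have e : ∀ y : {I : Ideal (𝓞 K) // Ideal.absNorm I = n},
          ((fun I : Ideal (𝓞 K) => ((Ideal.absNorm I : ℝ)) ^ (-s)) ∘
          (Equiv.sigmaFiberEquiv (fun I : Ideal (𝓞 K) => Ideal.absNorm I))) ⟨n, y⟩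
          = (n : ℝ) ^ (-s) := by
        intro y
        simp [Equiv.sigmaFiberEquiv, y.2]
      simp_rw [e]
      rw [tsum_fintype, Finset.sum_const, nsmul_eq_mul, Finset.card_univ,
        ← Nat.card_eq_fintype_card, LSeries.norm_term_eq]
      split_ifs with hn
      · subst hn
        simp [Real.zero_rpow (by linarith : -s ≠ 0)]
      · simp [Real.rpow_neg, div_eq_mul_inv]
  exact h.subtype {I | I ≠ ⊥}

theorem bs_zeta (K : Type*) [Field K] [NumberField K] (s : ℝ) (hs : 1 < s) :
    ∑' I : (Ideal (𝓞 K))⁰, ENNReal.ofReal ((Ideal.absNorm (I : Ideal (𝓞 K)) : ℝ) ^ (-s))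
      = ENNReal.ofReal (dedekindZetaReal K s) := by
  rw [dedekindZetaReal, ENNReal.ofReal_tsum_of_nonneg (fun _ => by positivity) (bs_summable K s hs)]
  rw [← (Equiv.subtypeEquivRight (p := fun I : Ideal (𝓞 K) => I ∈ (Ideal (𝓞 K))⁰)
    (q := fun I => I ≠ ⊥) (fun I => mem_nonZeroDivisors_iff_ne_zero)).tsum_eq]
  rfl

end NF4

/-- Brauer–Siegel-type bound: for a totally real number field `K` of degree `d`,
absolute discriminant `D`, class number `h_K` and regulator `R_K`, and any real
`t > 0`, one has
`R_K·h_K ≤ t(t+1)·2^{1−d}·(π^{−d}D)^{(1+t)/2}·Γ((1+t)/2)^d·ζ_K(1+t)`. -/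
theorem brauer_siegel_bound (K : Type*) [Field K] [NumberField K]
    (htr : ∀ v : InfinitePlace K, v.IsReal) (t : ℝ) (ht : 0 < t) :
    NumberField.Units.regulator K * (NumberField.classNumber K : ℝ)
      ≤ t * (t + 1) * (2 : ℝ) ^ ((1 : ℤ) - (Module.finrank ℚ K : ℤ)) *
        ((π : ℝ) ^ (-(Module.finrank ℚ K : ℤ)) * ((NumberField.discr K).natAbs : ℝ))
            ^ ((1 + t) / 2) *
        (Real.Gamma ((1 + t) / 2)) ^ (Module.finrank ℚ K) *
        dedekindZetaReal K (1 + t) := by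
  have hs : 1 < 1 + t := by linarith
  have h := bs_total htr (1 + t) hs
  have hR := NumberField.Units.regulator_pos K
  have hG : 0 < Real.Gamma ((1 + t) / 2) := Real.Gamma_pos_of_pos (by linarith)
  have hz : 0 ≤ dedekindZetaReal K (1 + t) := tsum_nonneg fun _ => by positivity
  have hD : (0 : ℝ) < |(discr K : ℝ)| := abs_pos.2 (Int.cast_ne_zero.2 (discr_ne_zero K))
  rw [bs_zeta K _ hs, ← ENNReal.ofReal_natCast, ← ENNReal.ofReal_ofNat,
    ← ENNReal.ofReal_mul (by positivity), ← ENNReal.ofReal_mul (by norm_num),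
    ← ENNReal.ofReal_mul (by positivity), ENNReal.ofReal_le_ofReal_iff (by positivity)] at h
  have eD : ((NumberField.discr K).natAbs : ℝ) = |(discr K : ℝ)| := by
    rw [Nat.cast_natAbs, Int.cast_abs]
  rw [eD]
  set D := |(discr K : ℝ)|
  set d := Module.finrank ℚ K
  set z := dedekindZetaReal K (1 + t)
  set G := Real.Gamma ((1 + t) / 2)
  set R := NumberField.Units.regulator K
  have e1 : (√D)⁻¹ ^ (1 + t) = (D ^ ((1 + t) / 2))⁻¹ := by
    rw [Real.inv_rpow (Real.sqrt_nonneg _), Real.sqrt_eq_rpow, ← Real.rpow_mul hD.le]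
    congr 2; ring
  have e2 : (π ^ (-(d : ℤ)) * D) ^ ((1 + t) / 2) = (π ^ (-(1 + t) / 2)) ^ d * D ^ ((1 + t) / 2) := by
    rw [Real.mul_rpow (by positivity) hD.le, ← Real.rpow_intCast, ← Real.rpow_mul pi_pos.le,
      ← Real.rpow_natCast, ← Real.rpow_mul pi_pos.le]
    congr 2; push_cast; ring
  have e3 : (2 : ℝ) ^ ((1 : ℤ) - (d : ℤ)) = 2 / 2 ^ d := by
    rw [zpow_sub₀ (by norm_num), zpow_one, zpow_natCast]
  rw [e1, mul_pow] at h
  rw [e2, e3]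
  set P := (π ^ (-(1 + t) / 2)) ^ d
  set Q := D ^ ((1 + t) / 2) with hQ
  have hQ0 : 0 < Q := Real.rpow_pos_of_pos hD _
  have e4 : (1 + t) - 1 = t := by ring
  rw [e4] at h
  have h5 := mul_le_mul_of_nonneg_left h
    (show 0 ≤ t * (t + 1) * Q / 2 ^ d by positivity)
  have e5 : t * (t + 1) * Q / 2 ^ d * ((classNumber K : ℝ) * (2 ^ d * R * (Q⁻¹ / ((1 + t) * t))))
      = R * classNumber K := by
    have : 1 + t ≠ 0 := by linarith
    field_simp
    ring
  rw [e5] at h5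
  refine h5.trans (le_of_eq ?_)
  ring
end
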